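/- Let P be a PO system and 𝒳 a complete semi-trim P-partition of the ω-Stone space W. Then: (1) 𝒳 is strongly semi-trim if and only if P̂ is weakly separated in P, i.e. whenever p ∈ P̂ and p = sup_P J for an ideal J of P̂, then p ∈ J; (2) 𝒳 is a rank partition of W if and only if every element of P̂ is compact in P. -/

import Mathlib

open Set Filter Topology

universe u v

/-- A PO system: a set with a transitive antisymmetric relation `<`. -/
structure POSystem (P : Type u) : Type u where
  lt : P → P → Prop
  lt_trans : ∀ {a b c}, lt a b → lt b c → lt a c
  lt_antisymm : ∀ {a b}, lt a b → lt b a → a = b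

namespace POSystem

variable {P : Type*} {Q : Type*}

/-- `a ≤ b` iff `a < b` or `a = b`. -/
def le (S : POSystem P) (a b : P) : Prop := S.lt a b ∨ a = b

theorem le_trans {S : POSystem P} {a b c : P} (h1 : S.le a b) (h2 : S.le b c) :
    S.le a c := by
  rcases h1 with h1 | rfl
  · rcases h2 with h2 | rfl
    · exact Or.inl (S.lt_trans h1 h2)
    · exact Or.inl h1
  · exact h2

/-- A morphism of PO systems. -/
def IsMorphism (SQ : POSystem Q) (SP : POSystem P) (α : Q → P) : Prop :=
  ∀ q : Q, α '' {r | SQ.lt q r} = {p | SP.lt (α q) p}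

/-- An isomorphism of PO systems. -/
def IsIso (SQ : POSystem Q) (SP : POSystem P) (β : Q → P) : Prop :=
  Function.Bijective β ∧ ∀ a b : Q, SQ.lt a b ↔ SP.lt (β a) (β b)

/-- An ideal of a PO system: a nonempty directed lower subset. -/
def IsIdeal (S : POSystem P) (J : Set P) : Prop :=
  J.Nonempty ∧ (∀ x ∈ J, ∀ y : P, S.le y x → y ∈ J) ∧
    ∀ x ∈ J, ∀ y ∈ J, ∃ z ∈ J, S.le x z ∧ S.le y z

/-- An ideal of a subset `Qs` of a PO system. -/
def IsIdealOf (S : POSystem P) (Qs : Set P) (J : Set P) : Prop :=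
  J.Nonempty ∧ J ⊆ Qs ∧ (∀ x ∈ J, ∀ y ∈ Qs, S.le y x → y ∈ J) ∧
    ∀ x ∈ J, ∀ y ∈ J, ∃ z ∈ J, S.le x z ∧ S.le y z

/-- The principal ideal `p↓`. -/
def principalIdeal (S : POSystem P) (p : P) : Set P := {q | S.le q p}

theorem principal_isIdeal (S : POSystem P) (p : P) : IsIdeal S (principalIdeal S p) :=
  ⟨⟨p, Or.inr rfl⟩, fun _ hx y hy => le_trans hy hx,
    fun _ hx _ hy => ⟨p, Or.inr rfl, hx, hy⟩⟩

/-- `p` is the supremum of the subset `A`. -/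
def IsSupOf (S : POSystem P) (p : P) (A : Set P) : Prop :=
  (∀ a ∈ A, S.le a p) ∧ ∀ q : P, (∀ a ∈ A, S.le a q) → S.le p q

/-- `p` is separated in `P` if it is not the supremum of a strictly increasing sequence. -/
def Separated (S : POSystem P) (p : P) : Prop :=
  ¬ ∃ u : ℕ → P, (∀ n, S.lt (u n) (u (n + 1)) ∧ u n ≠ u (n + 1)) ∧
      IsSupOf S p (Set.range u)

/-- `p` is compact in `P`. -/
def CompactIn (S : POSystem P) (p : P) : Prop :=
  ∀ J : Set P, IsIdeal S J → ∀ s : P, IsSupOf S s J → S.le p s → p ∈ J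

/-- The lower closure `N↓` of a subset. -/
def downSet (S : POSystem P) (N : Set P) : Set P := {p | ∃ q ∈ N, S.le p q}

/-- `N` has a finite foundation. -/
def HasFinFoundation (S : POSystem P) (N : Set P) : Prop :=
  ∃ F : Set P, F.Finite ∧ F ⊆ downSet S N ∧ ∀ r ∈ downSet S N, ∃ p ∈ F, S.le p r

def PDelta (S : POSystem P) : Set P := {p | HasFinFoundation S {p}}

def IsLowerSubset (S : POSystem P) (L : Set P) : Prop :=
  ∀ p ∈ L, ∀ q : P, S.le q p → q ∈ L

/-- Minimal elements of `L`. -/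
def minIn (S : POSystem P) (L : Set P) : Set P :=
  {p | p ∈ L ∧ ∀ q ∈ L, S.le q p → q = p}

/-- `L_min^d`: minimal elements of `L` lying in `P^d`. -/
def LminD (S : POSystem P) (L : Set P) : Set P := {p | p ∈ minIn S L ∧ ¬ S.lt p p}

/-- `(P, L, f)` is an extended PO system. -/
def IsExtPO (S : POSystem P) (L : Set P) (f : P → ℕ) : Prop :=
  IsLowerSubset S L ∧ L ⊆ PDelta S ∧ ∀ p ∈ LminD S L, 0 < f p

/-- The order relation on the ideal completion `id(P)`: ordered by inclusion, with
`id(P)^d` the principal ideals `p↓` for `p ∈ P^d`. -/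
def idLt (S : POSystem P) (J K : {J : Set P // IsIdeal S J}) : Prop :=
  (J.1 ⊆ K.1 ∧ J ≠ K) ∨ (J = K ∧ ¬ ∃ p : P, ¬ S.lt p p ∧ J.1 = principalIdeal S p)

/-- The ideal completion `id(P)` of a PO system. -/
def idPO (S : POSystem P) : POSystem {J : Set P // IsIdeal S J} where
  lt := idLt S
  lt_trans := by
    intro a b c h1 h2
    unfold idLt at h1 h2 ⊢
    rcases h1 with ⟨hab, hne⟩ | ⟨heq, h⟩
    · rcases h2 with ⟨hbc, hne'⟩ | ⟨heq', h'⟩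
      · refine Or.inl ⟨hab.trans hbc, fun hac => hne ?_⟩
        exact Subtype.ext (subset_antisymm hab (by rw [hac]; exact hbc))
      · rw [← heq']; exact Or.inl ⟨hab, hne⟩
    · rw [heq]; exact h2
  lt_antisymm := by
    intro a b h1 h2
    unfold idLt at h1 h2
    rcases h1 with ⟨hab, _⟩ | ⟨heq, _⟩
    · rcases h2 with ⟨hba, _⟩ | ⟨heq, _⟩
      · exact Subtype.ext (subset_antisymm hab hba)
      · exact heq.symm
    · exact heq

/-- The restriction of a PO system to a subset. -/
def restrictPO (S : POSystem P) (T : Set P) : POSystem T where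
  lt a b := S.lt a b
  lt_trans := fun h1 h2 => S.lt_trans h1 h2
  lt_antisymm := fun h1 h2 => Subtype.ext (S.lt_antisymm h1 h2)

end POSystem

open POSystem

section Partitions

variable {W : Type*} [TopologicalSpace W] {P : Type*} {Q : Type*}

/-- The derived set (set of limit points) of `A`. -/
def limitPts (A : Set W) : Set W := {x | x ∈ closure (A \ {x})}

/-- The type `T(A)` of a subset `A` with respect to a partition `X`. -/
def ptype (X : P → Set W) (A : Set W) : Set P := {p | (A ∩ X p).Nonempty}

/-- A `P`-partition of `W`: pairwise disjoint nonempty sets `X p` such that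
`(X p)' ∩ X = ⋃_{q < p} X q`. -/
def IsPPartition (S : POSystem P) (X : P → Set W) : Prop :=
  (∀ p, (X p).Nonempty) ∧ (Pairwise fun p q => Disjoint (X p) (X q)) ∧
    ∀ p, limitPts (X p) ∩ (⋃ q, X q) = ⋃ q ∈ {q : P | S.lt q p}, X q

/-- `A` is a `p`-trim set. -/
def IsTrimAt (S : POSystem P) (X : P → Set W) (A : Set W) (p : P) : Prop :=
  IsCompact A ∧ IsOpen A ∧ ptype X A = {q | S.le p q} ∧
    (¬ S.lt p p → ∃! x, x ∈ A ∩ X p)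

/-- `A` is a trim set. -/
def IsTrimSet (S : POSystem P) (X : P → Set W) (A : Set W) : Prop :=
  ∃ p, IsTrimAt S X A p

/-- `P̂`: the set of `p` for which some `p`-trim set exists. -/
def Phat (S : POSystem P) (X : P → Set W) : Set P := {p | ∃ A, IsTrimAt S X A p}

/-- Axiom T1: every point has a neighbourhood base of trim sets. -/
def HasTrimBases (S : POSystem P) (X : P → Set W) : Prop :=
  ∀ w : W, ∀ U ∈ nhds w, ∃ A, IsTrimSet S X A ∧ w ∈ A ∧ A ⊆ U

/-- Axiom T2 (fullness). -/
def IsFull (S : POSystem P) (X : P → Set W) : Prop :=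
  ∀ p ∈ Phat S X, ∀ w : W,
    (∀ U ∈ nhds w, ∃ A, IsTrimAt S X A p ∧ w ∈ A ∧ A ⊆ U) → w ∈ X p

/-- `w` is a clean point. -/
def IsCleanPt (S : POSystem P) (X : P → Set W) (w : W) : Prop :=
  ∃ p, w ∈ X p ∧ ∃ A, IsTrimAt S X A p ∧ w ∈ A

/-- Axiom T3: all points of `X` are clean. -/
def AllClean (S : POSystem P) (X : P → Set W) : Prop :=
  ∀ p : P, ∀ w ∈ X p, ∃ A, IsTrimAt S X A p ∧ w ∈ A

/-- A trim `P`-partition. -/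
def IsTrimPartition (S : POSystem P) (X : P → Set W) : Prop :=
  IsPPartition S X ∧ HasTrimBases S X ∧ IsFull S X ∧ AllClean S X

/-- A complete partition: the blocks cover `W`. -/
def IsCompletePartition (X : P → Set W) : Prop := (⋃ p, X p) = Set.univ

/-- `Y` refines `Z` via `α`. -/
def Refines (Y : Q → Set W) (Z : P → Set W) (α : Q → P) : Prop :=
  ∀ q, Y q ⊆ Z (α q)

/-- `Y` regularly refines `Z` via `α` (`Z` regularly consolidates `Y` via `α`). -/
def RegRefines (SQ : POSystem Q) (SP : POSystem P) (Y : Q → Set W) (Z : P → Set W)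
    (α : Q → P) : Prop :=
  Refines Y Z α ∧ ∀ p ∈ Phat SP Z, ∀ A : Set W, IsTrimAt SP Z A p → p ∈ α '' ptype Y A

/-- A semi-trim partition: T1, T2, and clean points are dense in each `X p`, `p ∈ P̂`. -/
def IsSemiTrim (S : POSystem P) (X : P → Set W) : Prop :=
  IsPPartition S X ∧ HasTrimBases S X ∧ IsFull S X ∧
    ∀ p ∈ Phat S X, X p ⊆ closure {w | w ∈ X p ∧ ∃ A, IsTrimAt S X A p ∧ w ∈ A}

/-- A strongly semi-trim partition: T1, T2, and all points of `X p` are clean, `p ∈ P̂`. -/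
def IsStronglySemiTrim (S : POSystem P) (X : P → Set W) : Prop :=
  IsPPartition S X ∧ HasTrimBases S X ∧ IsFull S X ∧
    ∀ p ∈ Phat S X, ∀ w ∈ X p, ∃ A, IsTrimAt S X A p ∧ w ∈ A

/-- The labels of a sequence are pairwise strictly incomparable or strictly increasing. -/
def PairwiseIncompOrStrictIncr (S : POSystem P) (τ : ℕ → P) : Prop :=
  (∀ j k, j ≠ k → ¬ S.le (τ j) (τ k)) ∨ (∀ j k, j < k → S.lt (τ j) (τ k) ∧ τ j ≠ τ k)

/-- A rank `P`-partition: a complete `P`-partition satisfying RP1 and RP2. -/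
def IsRankPartition (S : POSystem P) (X : P → Set W) : Prop :=
  IsPPartition S X ∧ IsCompletePartition X ∧
    (∀ q : P, Separated S q → ∀ (x : W) (u : ℕ → W) (τx : P) (τu : ℕ → P),
      x ∈ X τx → (∀ k, u k ∈ X (τu k)) →
      Filter.Tendsto u Filter.atTop (nhds x) → (∀ k, u k ≠ x) →
      S.le q τx → PairwiseIncompOrStrictIncr S τu →
      ∀ᶠ k in Filter.atTop, S.le q (τu k)) ∧
    (∀ (x : W) (τx : P), x ∈ X τx → ¬ Separated S τx →
      ∃ u : ℕ → W, Filter.Tendsto u Filter.atTop (nhds x) ∧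
        ∀ k, ∃ q, u k ∈ X q ∧ S.lt q τx ∧ q ≠ τx)

/-- `I_w`: the set of types of trim neighbourhoods of `w`. -/
def Iw (S : POSystem P) (X : P → Set W) (w : W) : Set P :=
  {p | ∃ A : Set W, IsTrimAt S X A p ∧ w ∈ A}

/-- A trim `(P, L, f)`-partition. -/
def IsTrimPLF (S : POSystem P) (L : Set P) (f : P → ℕ) (Z : P → Set W) : Prop :=
  IsTrimPartition S Z ∧ (∀ p, IsCompact (closure (Z p)) ↔ p ∈ L) ∧
    ∀ p ∈ LminD S L, Nat.card (Z p) = f p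

/-- A bounded trim `(P, L, f)`-partition. -/
def IsBoundedTrimPLF (S : POSystem P) (L : Set P) (f : P → ℕ) (Z : P → Set W) : Prop :=
  IsTrimPLF S L f Z ∧ IsCompact (closure (⋃ p ∈ L, Z p))

end Partitions

section Primitive

variable {W : Type*} [TopologicalSpace W]

/-- The ideal `(A)` of compact open subsets of `A`. -/
def coIdeal (A : Set W) : Set (Set W) := {C | IsCompact C ∧ IsOpen C ∧ C ⊆ A}

/-- `(A) ≅ (B)` as Boolean rings (equivalently, as posets). -/
def IdealIso (A B : Set W) : Prop := Nonempty (↥(coIdeal A) ≃o ↥(coIdeal B))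

/-- `(A) × (B) ≅ (A)`. -/
def ProdIdealIso (A B : Set W) : Prop :=
  Nonempty ((↥(coIdeal A) × ↥(coIdeal B)) ≃o ↥(coIdeal A))

/-- A compact open `A` is pseudo-indecomposable (PI). -/
def IsPISet (A : Set W) : Prop :=
  IsCompact A ∧ IsOpen A ∧ ∀ B : Set W, IsCompact B → IsOpen B → B ⊆ A →
    IdealIso B A ∨ IdealIso (A \ B) A

/-- `W` is primitive: every compact open set is a finite disjoint union of PI sets. -/
def PrimitiveSpace (W : Type*) [TopologicalSpace W] : Prop :=
  ∀ A : Set W, IsCompact A → IsOpen A →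
    ∃ (n : ℕ) (F : Fin n → Set W), (∀ i, IsPISet (F i)) ∧
      (Pairwise fun i j => Disjoint (F i) (F j)) ∧ A = ⋃ i, F i

/-- The setoid of PI compact opens up to isomorphism of their ideals. -/
def piIsoSetoid (W : Type*) [TopologicalSpace W] : Setoid {A : Set W // IsPISet A} where
  r A B := IdealIso A.1 B.1
  iseqv := ⟨fun _ => ⟨OrderIso.refl _⟩,
    fun h => h.elim fun e => ⟨e.symm⟩,
    fun h1 h2 => h1.elim fun e => h2.elim fun f => ⟨e.trans f⟩⟩

/-- The underlying set of the structure diagram `𝒮(W)`: isomorphism classes of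
PI compact open subsets of `W`. -/
def SDiagram (W : Type*) [TopologicalSpace W] : Type _ := Quotient (piIsoSetoid W)

/-- The relation on `𝒮(W)`: `[A] < [B]` iff `(A) × (B) ≅ (A)`. -/
def SDiagramLt {W : Type*} [TopologicalSpace W] (x y : SDiagram W) : Prop :=
  ∃ A B : {A : Set W // IsPISet A}, x = Quotient.mk (piIsoSetoid W) A ∧
    y = Quotient.mk (piIsoSetoid W) B ∧ ProdIdealIso A.1 B.1

/-- The blocks of the canonical partition `𝒳(W)`: points having a neighbourhood base
of compact open sets of class `p`. -/
def canonicalBlock {W : Type*} [TopologicalSpace W] (p : SDiagram W) : Set W :=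
  {w | ∀ U ∈ nhds w, ∃ A : {A : Set W // IsPISet A},
      Quotient.mk (piIsoSetoid W) A = p ∧ w ∈ A.1 ∧ A.1 ⊆ U}

/-- The setoid of points of `W` under the homeomorphism group. -/
def homeoSetoid (W : Type*) [TopologicalSpace W] : Setoid W where
  r w x := ∃ h : W ≃ₜ W, h w = x
  iseqv := ⟨fun w => ⟨Homeomorph.refl W, rfl⟩,
    fun h => h.elim fun e he => ⟨e.symm, by rw [← he, Homeomorph.symm_apply_apply]⟩,
    fun h1 h2 => h1.elim fun e he => h2.elim fun f hf =>
      ⟨e.trans f, by rw [Homeomorph.trans_apply, he, hf]⟩⟩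

end Primitive

section MyProof

variable {W : Type*} [TopologicalSpace W] {P : Type*}

theorem my_le_antisymm {S : POSystem P} {a b : P} (h1 : S.le a b) (h2 : S.le b a) : a = b := by
  rcases h1 with h1 | h1
  · rcases h2 with h2 | h2
    · exact S.lt_antisymm h1 h2
    · exact h2.symm
  · exact h1

theorem my_label_unique {S : POSystem P} {X : P → Set W} (hP : IsPPartition S X)
    {p q : P} {w : W} (hp : w ∈ X p) (hq : w ∈ X q) : p = q := by
  by_contra h
  exact Set.disjoint_left.1 (hP.2.1 h) hp hq

theorem my_label_le {S : POSystem P} {X : P → Set W} {A : Set W} {p q : P} {w : W}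
    (hA : IsTrimAt S X A p) (hw : w ∈ A) (hq : w ∈ X q) : S.le p q := by
  have : q ∈ ptype X A := ⟨w, hw, hq⟩
  rw [hA.2.2.1] at this
  exact this

theorem my_exists_pt {S : POSystem P} {X : P → Set W} {A : Set W} {p q : P}
    (hA : IsTrimAt S X A p) (h : S.le p q) : ∃ w, w ∈ A ∧ w ∈ X q := by
  have : q ∈ ptype X A := by rw [hA.2.2.1]; exact h
  exact this

theorem my_type_mono {S : POSystem P} {X : P → Set W} {A B : Set W} {p q : P}
    (hA : IsTrimAt S X A p) (hB : IsTrimAt S X B q) (h : B ⊆ A) : S.le p q := by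
  obtain ⟨w, hw, hq⟩ := my_exists_pt hB (Or.inr rfl)
  exact my_label_le hA (h hw) hq

theorem my_closure_le {S : POSystem P} {X : P → Set W} (hP : IsPPartition S X)
    {p q : P} {w : W} (hp : w ∈ X p) (hq : w ∈ closure (X q)) : S.le p q := by
  by_cases hw : w ∈ X q
  · exact Or.inr (my_label_unique hP hp hw)
  · have h1 : w ∈ limitPts (X q) ∩ ⋃ q, X q := by
      refine ⟨?_, Set.mem_iUnion.2 ⟨p, hp⟩⟩
      show w ∈ closure (X q \ {w})
      rwa [Set.diff_singleton_eq_self hw]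
    rw [hP.2.2 q] at h1
    simp only [Set.mem_iUnion, Set.mem_setOf_eq] at h1
    obtain ⟨r, hr, hwr⟩ := h1
    rw [my_label_unique hP hp hwr]
    exact Or.inl hr

theorem my_Iw_sup {S : POSystem P} {X : P → Set W} (hP : IsPPartition S X)
    (hT : HasTrimBases S X) {p : P} {w : W} (hp : w ∈ X p) : IsSupOf S p (Iw S X w) := by
  constructor
  · rintro a ⟨A, hA, hw⟩
    exact my_label_le hA hw hp
  · intro q hq
    apply my_closure_le hP hp
    rw [mem_closure_iff_nhds]
    intro U hU
    obtain ⟨A, ⟨s, hA⟩, hwA, hAU⟩ := hT w U hU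
    obtain ⟨y, hy, hyq⟩ := my_exists_pt hA (hq s ⟨A, hA, hwA⟩)
    exact ⟨y, hAU hy, hyq⟩

theorem my_refine {S : POSystem P} {X : P → Set W} (hT : HasTrimBases S X) {w : W} {p : P}
    (hp : p ∈ Iw S X w) {U : Set W} (hU : U ∈ nhds w) :
    ∃ s A, IsTrimAt S X A s ∧ w ∈ A ∧ A ⊆ U ∧ S.le p s := by
  obtain ⟨B, hB, hwB⟩ := hp
  obtain ⟨A, ⟨s, hA⟩, hwA, hAU⟩ := hT w (B ∩ U)
    (Filter.inter_mem (hB.2.1.mem_nhds hwB) hU)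
  exact ⟨s, A, hA, hwA, fun x hx => (hAU hx).2, my_type_mono hB hA fun x hx => (hAU hx).1⟩

theorem my_Iw_lower {S : POSystem P} {X : P → Set W} {w : W} {q r : P}
    (hq : q ∈ Iw S X w) (hr : r ∈ Phat S X) (h : S.le r q) : r ∈ Iw S X w := by
  by_cases hne : r = q
  · rw [hne]; exact hq
  obtain ⟨A, hA, hw⟩ := hq
  obtain ⟨B, hB⟩ := hr
  refine ⟨A ∪ B, ⟨hA.1.union hB.1, hA.2.1.union hB.2.1, ?_, ?_⟩, Or.inl hw⟩
  · ext s
    constructor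
    · rintro ⟨y, hy | hy, hs⟩
      · exact POSystem.le_trans h (my_label_le hA hy hs)
      · exact my_label_le hB hy hs
    · intro hs
      obtain ⟨y, hy, hys⟩ := my_exists_pt hB hs
      exact ⟨y, Or.inr hy, hys⟩
  · intro hd
    obtain ⟨x, hx, hu⟩ := hB.2.2.2 hd
    refine ⟨x, ⟨Or.inr hx.1, hx.2⟩, ?_⟩
    rintro y ⟨hy | hy, hyr⟩
    · exact absurd (my_le_antisymm h (my_label_le hA hy hyr)) hne
    · exact hu y ⟨hy, hyr⟩

theorem my_Iw_nonempty {S : POSystem P} {X : P → Set W} (hT : HasTrimBases S X) (w : W) :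
    (Iw S X w).Nonempty := by
  obtain ⟨A, ⟨s, hA⟩, hwA, -⟩ := hT w Set.univ Filter.univ_mem
  exact ⟨s, A, hA, hwA⟩

theorem my_Iw_directed {S : POSystem P} {X : P → Set W} (hT : HasTrimBases S X) (w : W)
    {q r : P} (hq : q ∈ Iw S X w) (hr : r ∈ Iw S X w) :
    ∃ z ∈ Iw S X w, S.le q z ∧ S.le r z := by
  obtain ⟨B, hB, hwB⟩ := hr
  obtain ⟨s, A, hA, hw, hs, hl⟩ := my_refine hT hq (hB.2.1.mem_nhds hwB)
  exact ⟨s, ⟨A, hA, hw⟩, hl, my_type_mono hB hA hs⟩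

theorem my_Iw_sub {S : POSystem P} {X : P → Set W} {w : W} : Iw S X w ⊆ Phat S X :=
  fun _ ⟨A, hA, _⟩ => ⟨A, hA⟩

theorem my_Iw_ideal {S : POSystem P} {X : P → Set W} (hT : HasTrimBases S X) (w : W) :
    IsIdealOf S (Phat S X) (Iw S X w) :=
  ⟨my_Iw_nonempty hT w, my_Iw_sub, fun _ hx _ hy h => my_Iw_lower hx hy h,
    fun _ hx _ hy => my_Iw_directed hT w hx hy⟩

theorem my_Phat_countable [SecondCountableTopology W] {S : POSystem P} {X : P → Set W} :
    (Phat S X).Countable := by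
  have hb := TopologicalSpace.isBasis_countableBasis W
  have key : ∀ p ∈ Phat S X, ∃ U ∈ TopologicalSpace.countableBasis W,
      p ∈ ptype X U ∧ ∀ q ∈ ptype X U, S.le p q := by
    rintro p ⟨A, hA⟩
    obtain ⟨w, hw, hp⟩ := my_exists_pt hA (Or.inr rfl)
    obtain ⟨U, hU, hwU, hUA⟩ := hb.exists_subset_of_mem_open hw hA.2.1
    refine ⟨U, hU, ⟨w, hwU, hp⟩, ?_⟩
    rintro q ⟨y, hy, hq⟩
    exact my_label_le hA (hUA hy) hq
  choose! f hf hf1 hf2 using key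
  refine Set.MapsTo.countable_of_injOn (f := f) (t := TopologicalSpace.countableBasis W)
    (fun p hp => hf p hp) ?_ (TopologicalSpace.countable_countableBasis W)
  intro p hp q hq h
  refine my_le_antisymm (hf2 p hp q ?_) (hf2 q hq p ?_)
  · rw [h]; exact hf1 q hq
  · rw [← h]; exact hf1 p hp

theorem my_cofinal {S : POSystem P} {J : Set P} (hne : J.Nonempty) (hc : J.Countable)
    (hd : ∀ x ∈ J, ∀ y ∈ J, ∃ z ∈ J, S.le x z ∧ S.le y z) :
    ∃ p : ℕ → P, (∀ n, p n ∈ J) ∧ (∀ n, S.le (p n) (p (n + 1))) ∧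
      ∀ q ∈ J, ∃ n, S.le q (p n) := by
  obtain ⟨e, he⟩ := hc.exists_eq_range hne
  have hm : ∀ n, e n ∈ J := fun n => by rw [he]; exact ⟨n, rfl⟩
  choose! z hz hz1 hz2 using hd
  let p : ℕ → P := fun n => Nat.rec (e 0) (fun n x => z x (e n)) n
  have hp : ∀ n, p n ∈ J := by
    intro n
    induction n with
    | zero => exact hm 0
    | succ n ih => exact hz _ ih _ (hm n)
  refine ⟨p, hp, fun n => hz1 _ (hp n) _ (hm n), ?_⟩
  intro q hq
  rw [he] at hq
  obtain ⟨n, rfl⟩ := hq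
  exact ⟨n + 1, hz2 _ (hp n) _ (hm n)⟩

theorem my_seq [SecondCountableTopology W] {S : POSystem P} {X : P → Set W}
    (hP : IsPPartition S X) (hT : HasTrimBases S X) {w : W} {t : P} (ht : w ∈ X t)
    (hn : t ∉ Iw S X w) :
    ∃ (r : ℕ → P) (u : ℕ → W), (∀ n, r n ∈ Iw S X w) ∧
      (∀ n, S.lt (r n) (r (n + 1)) ∧ r n ≠ r (n + 1)) ∧ (∀ n, u n ∈ X (r n)) ∧
      Filter.Tendsto u Filter.atTop (nhds w) ∧ ∀ q ∈ Iw S X w, ∃ n, S.le q (r n) := by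
  obtain ⟨U, hU⟩ := (nhds w).exists_antitone_basis
  have hsup := my_Iw_sup hP hT ht
  have step : ∀ (n : ℕ) (r : P), r ∈ Iw S X w → ∃ r', (S.lt r r' ∧ r ≠ r') ∧
      ∃ A, IsTrimAt S X A r' ∧ w ∈ A ∧ A ⊆ U n := by
    intro n r hr
    have : ∃ r₁ ∈ Iw S X w, ¬ S.le r₁ r := by
      by_contra hcon
      push Not at hcon
      have h1 := hsup.2 r hcon
      have h2 := hsup.1 r hr
      rw [my_le_antisymm h2 h1] at hr
      exact hn hr
    obtain ⟨r₁, hr₁, hnot⟩ := this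
    obtain ⟨r₂, hr₂, h12, h02⟩ := my_Iw_directed hT w hr₁ hr
    obtain ⟨s, A, hA, hw, hs, hl⟩ := my_refine hT hr₂ (hU.1.mem_of_mem (i := n) trivial)
    have hne : r ≠ s := by
      rintro rfl
      exact hnot (POSystem.le_trans h12 hl)
    refine ⟨s, ⟨?_, hne⟩, A, hA, hw, hs⟩
    rcases POSystem.le_trans h02 hl with h | h
    · exact h
    · exact absurd h hne
  choose! f hf g hg hgw hgU using step
  obtain ⟨r₀, hr₀⟩ := my_Iw_nonempty hT w
  let r : ℕ → P := fun n => Nat.rec r₀ (fun n x => f n x) n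
  have hr : ∀ n, r n ∈ Iw S X w := by
    intro n
    induction n with
    | zero => exact hr₀
    | succ n ih => exact ⟨_, hg n _ ih, hgw n _ ih⟩
  have hu : ∀ n, ∃ y, y ∈ U n ∧ y ∈ X (r (n + 1)) := by
    intro n
    obtain ⟨y, hy, hy'⟩ := my_exists_pt (hg n _ (hr n)) (Or.inr rfl)
    exact ⟨y, hgU n _ (hr n) hy, hy'⟩
  choose u hu1 hu2 using hu
  refine ⟨fun n => r (n + 1), u, fun n => hr (n + 1), fun n => hf (n + 1) (r (n + 1)) (hr (n + 1)), hu2,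
    hU.tendsto hu1, ?_⟩
  rintro q ⟨A, hA, hwA⟩
  obtain ⟨n, -, hn⟩ := hU.1.mem_iff.1 (hA.2.1.mem_nhds hwA)
  exact ⟨n, my_type_mono hA (hg n _ (hr n)) ((hgU n _ (hr n)).trans hn)⟩

theorem my_realize [SecondCountableTopology W] [LocallyCompactSpace W] [T2Space W]
    {S : POSystem P} {X : P → Set W}
    (hsemi : IsSemiTrim S X) {J : Set P} (hJ : IsIdealOf S (Phat S X) J) :
    ∃ w, Iw S X w = J := by
  obtain ⟨hP, hT, -, hdense⟩ := hsemi
  obtain ⟨hne, hsub, hlow, hdir⟩ := hJ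
  obtain ⟨p, hp, hmono, hcof⟩ := my_cofinal hne (my_Phat_countable.mono hsub) hdir
  letI := TopologicalSpace.metrizableSpaceMetric W
  have step : ∀ (n : ℕ) (A : Set W), IsTrimAt S X A (p n) →
      ∃ B, IsTrimAt S X B (p (n + 1)) ∧ B ⊆ A ∧
        ∃ c, B ⊆ Metric.ball c (1 / ((n : ℝ) + 1)) := by
    intro n A hA
    obtain ⟨y, hyA, hy⟩ := my_exists_pt hA (hmono n)
    have hy2 := hdense _ (hsub (hp (n + 1))) hy
    rw [mem_closure_iff] at hy2
    obtain ⟨c, hcA, hc, C, hC, hcC⟩ := hy2 A hA.2.1 hyA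
    obtain ⟨s, B, hB, hcB, hBs, hl⟩ := my_refine hT (U := A ∩ Metric.ball c (1 / ((n : ℝ) + 1)))
      ⟨C, hC, hcC⟩ (Filter.inter_mem (hA.2.1.mem_nhds hcA)
        (Metric.ball_mem_nhds c Nat.one_div_pos_of_nat))
    have : p (n + 1) = s := my_le_antisymm hl (my_label_le hB hcB hc)
    subst this
    exact ⟨B, hB, fun x hx => (hBs hx).1, c, fun x hx => (hBs hx).2⟩
  choose f hf hfA c hc using step
  obtain ⟨A₀, hA₀⟩ := hsub (hp 0)
  let A : (n : ℕ) → {A : Set W // IsTrimAt S X A (p n)} := fun n =>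
    Nat.rec ⟨A₀, hA₀⟩ (fun n B => ⟨f n B.1 B.2, hf n B.1 B.2⟩) n
  have hdec : ∀ n, (A (n + 1)).1 ⊆ (A n).1 := fun n => hfA n _ (A n).2
  have hball : ∀ n, ∃ c, (A (n + 1)).1 ⊆ Metric.ball c (1 / ((n : ℝ) + 1)) :=
    fun n => ⟨_, hc n _ (A n).2⟩
  obtain ⟨w, hw⟩ := IsCompact.nonempty_iInter_of_sequence_nonempty_isCompact_isClosed
    (fun n => (A n).1) hdec
    (fun n => by
      obtain ⟨y, hy, -⟩ := my_exists_pt (A n).2 (Or.inr rfl)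
      exact ⟨y, hy⟩) (A 0).2.1 (fun n => (A n).2.1.isClosed)
  rw [Set.mem_iInter] at hw
  refine ⟨w, Set.Subset.antisymm ?_ ?_⟩
  · rintro q ⟨B, hB, hwB⟩
    obtain ⟨ε, hε, hεB⟩ := Metric.isOpen_iff.1 hB.2.1 w hwB
    obtain ⟨n, hn⟩ := exists_nat_one_div_lt (half_pos hε)
    obtain ⟨c, hc⟩ := hball n
    have : (A (n + 1)).1 ⊆ B := by
      intro x hx
      apply hεB
      have h1 := Metric.mem_ball.1 (hc hx)
      have h2 := Metric.mem_ball.1 (hc (hw (n + 1)))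
      have h3 := dist_triangle_right x w c
      rw [Metric.mem_ball]
      linarith
    exact hlow _ (hp (n + 1)) _ ⟨B, hB⟩ (my_type_mono hB (A (n + 1)).2 this)
  · intro q hq
    obtain ⟨n, hn⟩ := hcof q hq
    exact my_Iw_lower ⟨(A n).1, (A n).2, hw n⟩ (hsub hq) hn

theorem my_chain {S : POSystem P} {r : ℕ → P} (h : ∀ n, S.lt (r n) (r (n + 1)) ∧ r n ≠ r (n + 1)) :
    ∀ j k, j < k → S.lt (r j) (r k) ∧ r j ≠ r k := by
  have h1 : ∀ j k, j < k → S.lt (r j) (r k) := by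
    intro j k hjk
    induction k, hjk using Nat.le_induction with
    | base => exact (h j).1
    | succ k _ ih => exact S.lt_trans ih (h k).1
  intro j k hjk
  refine ⟨h1 j k hjk, fun he => ?_⟩
  rcases Nat.lt_or_ge (j + 1) k with h2 | h2
  · have h3 := h1 _ _ h2
    rw [← he] at h3
    exact (h j).2 (S.lt_antisymm (h j).1 h3)
  · have : k = j + 1 := by omega
    subst this
    exact (h j).2 he

theorem my_compact_sep {S : POSystem P} {p : P} (h : CompactIn S p) : Separated S p := by
  rintro ⟨u, hu, hs⟩
  have hch := my_chain hu
  have hle : ∀ i j, i ≤ j → S.le (u i) (u j) := by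
    intro i j hij
    rcases hij.lt_or_eq with h | h
    · exact Or.inl (hch _ _ h).1
    · exact Or.inr (by rw [h])
  have := h (downSet S (Set.range u)) ⟨⟨u 0, u 0, ⟨0, rfl⟩, Or.inr rfl⟩, ?_, ?_⟩ p ⟨?_, ?_⟩
    (Or.inr rfl)
  · obtain ⟨_, ⟨n, rfl⟩, hn⟩ := this
    exact (hu n).2 (my_le_antisymm (Or.inl (hu n).1)
      (POSystem.le_trans (hs.1 _ ⟨n + 1, rfl⟩) hn))
  · rintro x ⟨y, hy, hxy⟩ z hz
    exact ⟨y, hy, POSystem.le_trans hz hxy⟩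
  · rintro x ⟨_, ⟨i, rfl⟩, hx⟩ y ⟨_, ⟨j, rfl⟩, hy⟩
    exact ⟨u (max i j), ⟨_, ⟨_, rfl⟩, Or.inr rfl⟩,
      POSystem.le_trans hx (hle _ _ (le_max_left _ _)),
      POSystem.le_trans hy (hle _ _ (le_max_right _ _))⟩
  · rintro a ⟨y, hy, hay⟩
    exact POSystem.le_trans hay (hs.1 y hy)
  · intro q hq
    exact hs.2 q fun a ha => hq a ⟨a, ha, Or.inr rfl⟩

theorem my_sep_mem [SecondCountableTopology W] {S : POSystem P} {X : P → Set W}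
    (hP : IsPPartition S X) (hT : HasTrimBases S X) {w : W} {t : P} (ht : w ∈ X t)
    (hs : Separated S t) : t ∈ Iw S X w := by
  by_contra hn
  obtain ⟨r, u, hr, hlt, -, -, hcof⟩ := my_seq hP hT ht hn
  have hsup := my_Iw_sup hP hT ht
  refine hs ⟨r, hlt, ?_, ?_⟩
  · rintro _ ⟨n, rfl⟩
    exact hsup.1 _ (hr n)
  · intro q hq
    refine hsup.2 q fun a ha => ?_
    obtain ⟨n, hn⟩ := hcof a ha
    exact POSystem.le_trans hn (hq _ ⟨n, rfl⟩)

theorem my_compact_mem {S : POSystem P} {X : P → Set W}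
    (hP : IsPPartition S X) (hT : HasTrimBases S X) {w : W} {t q : P} (ht : w ∈ X t)
    (hq : CompactIn S q) (hqt : S.le q t) : ∃ r ∈ Iw S X w, S.le q r := by
  have hsup := my_Iw_sup hP hT ht
  obtain ⟨r₀, hr₀⟩ := my_Iw_nonempty hT w
  refine hq (downSet S (Iw S X w)) ⟨⟨r₀, r₀, hr₀, Or.inr rfl⟩, ?_, ?_⟩ t ⟨?_, ?_⟩ hqt
  · rintro x ⟨y, hy, hxy⟩ z hz
    exact ⟨y, hy, POSystem.le_trans hz hxy⟩
  · rintro x ⟨i, hi, hx⟩ y ⟨j, hj, hy⟩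
    obtain ⟨z, hz, h1, h2⟩ := my_Iw_directed hT w hi hj
    exact ⟨z, ⟨z, hz, Or.inr rfl⟩, POSystem.le_trans hx h1, POSystem.le_trans hy h2⟩
  · rintro a ⟨y, hy, hay⟩
    exact POSystem.le_trans hay (hsup.1 y hy)
  · intro q hq
    exact hsup.2 q fun a ha => hq a ⟨a, ha, Or.inr rfl⟩

theorem my_rank_sep {S : POSystem P} {X : P → Set W} (hR : IsRankPartition S X)
    {p : P} (hp : p ∈ Phat S X) : Separated S p := by
  by_contra hn
  obtain ⟨A, hA⟩ := hp
  obtain ⟨w, hw, hwp⟩ := my_exists_pt hA (Or.inr rfl)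
  obtain ⟨u, hu, hq⟩ := hR.2.2.2 w p hwp hn
  obtain ⟨k, hk⟩ := (hu.eventually (hA.2.1.mem_nhds hw)).exists
  obtain ⟨q, huq, hlt, hne⟩ := hq k
  exact hne (my_le_antisymm (Or.inl hlt) (my_label_le hA hk huq))

theorem my_rank_mem [SecondCountableTopology W] {S : POSystem P} {X : P → Set W}
    (hR : IsRankPartition S X) (hT : HasTrimBases S X)
    {w : W} {t q : P} (ht : w ∈ X t) (hq : q ∈ Phat S X) (h : S.le q t) : q ∈ Iw S X w := by
  by_cases hn : t ∈ Iw S X w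
  · exact my_Iw_lower hn hq h
  obtain ⟨r, u, hr, hlt, hur, hu, -⟩ := my_seq hR.1 hT ht hn
  obtain ⟨k, hk⟩ := (hR.2.2.1 q (my_rank_sep hR hq) w u t r ht hur hu
    (fun k hk => hn (by
      have h1 := hur k
      rw [hk] at h1
      rw [my_label_unique hR.1 ht h1]
      exact hr k)) h (Or.inr (my_chain hlt))).exists
  exact my_Iw_lower (hr k) hq hk

end MyProof

/-- for a complete semi-trim `P`-partition: (1) it is strongly semi-trim
iff `P̂` is weakly separated in `P`; (2) it is a rank partition iff every element of `P̂`
is compact in `P`. -/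
theorem semiTrim_completeness_conditions {P : Type u} {W : Type v}
    [TopologicalSpace W] [SecondCountableTopology W] [LocallyCompactSpace W]
    [T2Space W] [TotallyDisconnectedSpace W]
    (S : POSystem P) (X : P → Set W)
    (hsemi : IsSemiTrim S X) (hcomp : IsCompletePartition X) :
    (IsStronglySemiTrim S X ↔
      ∀ p ∈ Phat S X, ∀ J : Set P, POSystem.IsIdealOf S (Phat S X) J →
        POSystem.IsSupOf S p J → p ∈ J) ∧
    (IsRankPartition S X ↔ ∀ p ∈ Phat S X, POSystem.CompactIn S p) := by
  have hP := hsemi.1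
  have hT := hsemi.2.1
  have hcov : ∀ w, ∃ t, w ∈ X t := fun w => Set.mem_iUnion.1 (by
    have : (⋃ p, X p) = Set.univ := hcomp
    rw [this]; trivial)
  have huniq : ∀ {w : W} {t s : P} {K : Set P}, w ∈ X t → Iw S X w = K → IsSupOf S s K →
      t = s := by
    intro w t s K hw hK hs
    have h := my_Iw_sup hP hT hw
    rw [hK] at h
    exact my_le_antisymm (h.2 s hs.1) (hs.2 t h.1)
  refine ⟨⟨?_, ?_⟩, ⟨?_, ?_⟩⟩
  · intro hstr p hp J hJ hs
    obtain ⟨w, hw⟩ := my_realize hsemi hJ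
    obtain ⟨t, ht⟩ := hcov w
    have := huniq ht hw hs
    subst this
    rw [← hw]
    exact hstr.2.2.2 t hp w ht
  · intro h
    refine ⟨hP, hT, hsemi.2.2.1, ?_⟩
    intro p hp w hw
    exact h p hp (Iw S X w) (my_Iw_ideal hT w) (my_Iw_sup hP hT hw)
  · intro hR p hp J hJ s hs hps
    have hmem : ∀ {y x : P}, y ∈ J → ∀ {w}, w ∈ X y → x ∈ Iw S X w → x ∈ J ∩ Phat S X := by
      intro y x hy w hw hx
      exact ⟨hJ.2.1 y hy x ((my_Iw_sup hP hT hw).1 x hx), my_Iw_sub hx⟩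
    have hK : IsIdealOf S (Phat S X) (J ∩ Phat S X) := by
      refine ⟨?_, Set.inter_subset_right, ?_, ?_⟩
      · obtain ⟨y, hy⟩ := hJ.1
        obtain ⟨w, hw⟩ := hP.1 y
        obtain ⟨x, hx⟩ := my_Iw_nonempty hT w
        exact ⟨x, hmem hy hw hx⟩
      · rintro x ⟨hx, -⟩ y hy hyx
        exact ⟨hJ.2.1 x hx y hyx, hy⟩
      · rintro x ⟨hx, hx'⟩ y ⟨hy, hy'⟩
        obtain ⟨z, hz, hxz, hyz⟩ := hJ.2.2 x hx y hy
        obtain ⟨w, hw⟩ := hP.1 z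
        obtain ⟨v, hv, h1, h2⟩ := my_Iw_directed hT w (my_rank_mem hR hT hw hx' hxz)
          (my_rank_mem hR hT hw hy' hyz)
        exact ⟨v, hmem hz hw hv, h1, h2⟩
    have hKs : IsSupOf S s (J ∩ Phat S X) := by
      refine ⟨fun a ha => hs.1 a ha.1, fun q hq => hs.2 q fun a ha => ?_⟩
      obtain ⟨w, hw⟩ := hP.1 a
      exact (my_Iw_sup hP hT hw).2 q fun b hb => hq b (hmem ha hw hb)
    obtain ⟨w, hw⟩ := my_realize hsemi hK
    obtain ⟨t, ht⟩ := hcov w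
    have := huniq ht hw hKs
    subst this
    have h1 := my_rank_mem hR hT ht hp hps
    rw [hw] at h1
    exact h1.1
  · intro hC
    refine ⟨hP, hcomp, ?_, ?_⟩
    · intro q hq x u t τ hx hu hlim _ hqt _
      obtain ⟨y, hy⟩ := hP.1 q
      obtain ⟨r, ⟨A, hA, hxA⟩, hqr⟩ := my_compact_mem hP hT hx
        (hC q (my_Iw_sub (my_sep_mem hP hT hy hq))) hqt
      filter_upwards [hlim.eventually (hA.2.1.mem_nhds hxA)] with k hk
      exact POSystem.le_trans hqr (my_label_le hA hk (hu k))
    · intro x t hx hns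
      have hn : t ∉ Iw S X x := fun h => hns (my_compact_sep (hC t (my_Iw_sub h)))
      obtain ⟨r, u, hr, -, hur, hu, -⟩ := my_seq hP hT hx hn
      refine ⟨u, hu, fun k => ⟨r k, hur k, ?_⟩⟩
      have hne : r k ≠ t := fun h => hn (h ▸ hr k)
      rcases (my_Iw_sup hP hT hx).1 _ (hr k) with h | h
      · exact ⟨h, hne⟩
      · exact absurd h hne
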